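/- Fix n ≥ 1, ℓ ≥ 0, and 0 < μ < 1. There exist positive constants D and α (depending only on n, ℓ, μ) such that for every positive integer M, every R > 0, and every real symmetric positive definite y with y ≥ μ·I_n, the tail sum over positive definite T with M*T half-integral and det(T) ≥ R of det(T)^{ℓ/2} det(y)^{ℓ/2} e^{-2π tr(Ty)} is at most D * M^α * e^{-π μ n R^{1/n} / 2}. -/

import Mathlib

open Real

/-- A real symmetric matrix is half-integral if its diagonal entries are integers
and its off-diagonal entries lie in (1/2)ℤ. -/
def IsHalfIntegral {n : ℕ} (T : Matrix (Fin n) (Fin n) ℝ) : Prop :=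
  (∀ i, ∃ z : ℤ, T i i = z) ∧ ∀ i j, i ≠ j → ∃ z : ℤ, T i j = z / 2

lemma aux_decomp {n : ℕ} {T : Matrix (Fin n) (Fin n) ℝ} (hT : T.PosSemidef) :
    ∃ B : Matrix (Fin n) (Fin n) ℝ, T = B.conjTranspose * B := by
  open scoped MatrixOrder in
  exact (CStarAlgebra.nonneg_iff_eq_star_mul_self (a := T)).1 hT.nonneg

lemma aux_amgm {n : ℕ} (hn : 1 ≤ n) {A : Matrix (Fin n) (Fin n) ℝ} (hA : A.PosSemidef) :
    0 ≤ A.trace ∧ 0 ≤ A.det ∧ A.det ^ ((1 : ℝ) / n) ≤ A.trace / n := by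
  have hn0 : (0 : ℝ) < n := by exact_mod_cast hn
  have h := Real.geom_mean_le_arith_mean_weighted Finset.univ
    (fun _ : Fin n => (1 : ℝ) / n) hA.isHermitian.eigenvalues
    (fun _ _ => by positivity) (by simp [hn0.ne']) (fun i _ => hA.eigenvalues_nonneg i)
  have hdet : A.det = ∏ i, hA.isHermitian.eigenvalues i := by
    simpa using hA.isHermitian.det_eq_prod_eigenvalues
  have htr : A.trace = ∑ i, hA.isHermitian.eigenvalues i := by
    simpa using hA.isHermitian.trace_eq_sum_eigenvalues
  refine ⟨?_, ?_, ?_⟩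
  · rw [htr]; exact Finset.sum_nonneg fun i _ => hA.eigenvalues_nonneg i
  · rw [hdet]; exact Finset.prod_nonneg fun i _ => hA.eigenvalues_nonneg i
  · rw [hdet, htr, ← Real.finsetProd_rpow _ _ (fun i _ => hA.eigenvalues_nonneg i)]
    rw [← Finset.mul_sum] at h
    calc _ ≤ _ := h
      _ = _ := by ring

lemma aux_mul {n : ℕ} (hn : 1 ≤ n) {T y : Matrix (Fin n) (Fin n) ℝ}
    (hT : T.PosSemidef) (hy : y.PosSemidef) :
    0 ≤ (T * y).trace ∧ 0 ≤ (T * y).det ∧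
      (T * y).det ^ ((1 : ℝ) / n) ≤ (T * y).trace / n := by
  obtain ⟨B, rfl⟩ := aux_decomp hT
  have h := aux_amgm hn (hy.mul_mul_conjTranspose_same B)
  have h1 : (B * y * B.conjTranspose).trace = (B.conjTranspose * B * y).trace := by
    rw [Matrix.trace_mul_comm, Matrix.mul_assoc]
  have h2 : (B * y * B.conjTranspose).det = (B.conjTranspose * B * y).det := by
    simp only [Matrix.det_mul]; ring
  rwa [h1, h2] at h

lemma aux_entry {n : ℕ} {T : Matrix (Fin n) (Fin n) ℝ} (hT : T.PosSemidef) (i j : Fin n) :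
    |T i j| ≤ T.trace := by
  obtain ⟨B, rfl⟩ := aux_decomp hT
  have hd : ∀ i, (B.conjTranspose * B) i i = ∑ k, B k i ^ 2 := by
    intro i; simp [Matrix.mul_apply, sq]
  have hle : ∀ i, ∑ k, B k i ^ 2 ≤ (B.conjTranspose * B).trace := by
    intro i
    simp only [Matrix.trace, Matrix.diag, hd]
    exact Finset.single_le_sum (f := fun i => ∑ k, B k i ^ 2)
      (fun i _ => Finset.sum_nonneg fun k _ => sq_nonneg _) (Finset.mem_univ i)
  have h1 : |(B.conjTranspose * B) i j| ≤ ∑ k, (B k i ^ 2 + B k j ^ 2) / 2 := by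
    simp only [Matrix.mul_apply, Matrix.conjTranspose_apply, star_trivial]
    refine (Finset.abs_sum_le_sum_abs _ _).trans (Finset.sum_le_sum fun k _ => ?_)
    rw [abs_le]
    constructor <;> nlinarith [sq_nonneg (B k i + B k j), sq_nonneg (B k i - B k j)]
  rw [← Finset.sum_div, Finset.sum_add_distrib] at h1
  linarith [hle i, hle j]

lemma aux_pow (k : ℝ) (hk : 0 ≤ k) (x : ℝ) (hx : 0 ≤ x) :
    x ^ k ≤ (k + 1) ^ k * Real.exp x := by
  have h1 : x / (k + 1) ≤ Real.exp (x / (k + 1)) := by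
    linarith [Real.add_one_le_exp (x / (k + 1))]
  have h2 : x = (k + 1) * (x / (k + 1)) := by field_simp
  calc x ^ k = (k + 1) ^ k * (x / (k + 1)) ^ k := by
        rw [← Real.mul_rpow (by positivity) (by positivity), ← h2]
    _ ≤ (k + 1) ^ k * Real.exp (x / (k + 1)) ^ k := by gcongr
    _ ≤ (k + 1) ^ k * Real.exp x := by
        rw [← Real.exp_mul]
        gcongr
        rw [div_mul_eq_mul_div, div_le_iff₀ (by positivity)]
        nlinarith

lemma aux_geom (a : ℝ) (ha : 0 < a) (N : ℕ) :
    ∑ m ∈ Finset.range N, Real.exp (-(a * m)) ≤ 1 + 1 / a := by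
  have hr : Real.exp (-a) < 1 := by rw [Real.exp_lt_one_iff]; linarith
  have h0 : 0 < Real.exp (-a) := Real.exp_pos _
  have h1 : ∀ m : ℕ, Real.exp (-(a * m)) = Real.exp (-a) ^ m := by
    intro m; rw [← Real.exp_nat_mul]; congr 1; ring
  simp only [h1]
  have h2 := (summable_geometric_of_lt_one h0.le hr).sum_le_tsum (Finset.range N)
    (fun i _ => by positivity)
  rw [tsum_geometric_of_lt_one h0.le hr] at h2
  refine h2.trans ?_
  have h3 : Real.exp (-a) ≤ 1 / (1 + a) := by
    rw [Real.exp_neg, ← one_div]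
    apply one_div_le_one_div_of_le (by positivity)
    linarith [Real.add_one_le_exp a]
  have h4 : a / (1 + a) ≤ 1 - Real.exp (-a) := by
    have : a / (1 + a) = 1 - 1 / (1 + a) := by field_simp; ring
    linarith
  calc (1 - Real.exp (-a))⁻¹ ≤ (a / (1 + a))⁻¹ := by
        apply inv_anti₀ (by positivity) h4
    _ = 1 + 1 / a := by field_simp; ring

lemma aux_int (a : ℝ) (ha : 0 < a) (N : ℕ) :
    ∑ z ∈ Finset.Icc (-(N : ℤ)) N, Real.exp (-(a * |(z : ℝ)|)) ≤ 2 * (1 + 1 / a) := by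
  have hsub : Finset.Icc (-(N : ℤ)) N ⊆
      (Finset.range (N + 1)).image (fun m : ℕ => (m : ℤ)) ∪
      (Finset.range (N + 1)).image (fun m : ℕ => -(m : ℤ)) := by
    intro z hz
    simp only [Finset.mem_Icc] at hz
    simp only [Finset.mem_union, Finset.mem_image, Finset.mem_range]
    rcases le_total 0 z with h | h
    · left; exact ⟨z.toNat, by omega, by omega⟩
    · right; exact ⟨(-z).toNat, by omega, by omega⟩
  have hg := aux_geom a ha (N + 1)
  refine (Finset.sum_le_sum_of_subset_of_nonneg hsub (fun _ _ _ => by positivity)).trans ?_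
  refine (le_add_of_nonneg_right (Finset.sum_nonneg
    (s := (Finset.range (N + 1)).image (fun m : ℕ => (m : ℤ)) ∩
      (Finset.range (N + 1)).image (fun m : ℕ => -(m : ℤ)))
    (f := fun z : ℤ => Real.exp (-(a * |(z : ℝ)|))) fun _ _ => by positivity)).trans ?_
  rw [Finset.sum_union_inter]
  · rw [Finset.sum_image (by intro a _ b _ h; simpa using h),
        Finset.sum_image (by intro a _ b _ h; simpa using h)]
    simp only [Int.cast_neg, abs_neg, Int.cast_natCast, Nat.abs_cast]
    linarith

lemma aux_entry_int {n : ℕ} {M : ℕ} {T : Matrix (Fin n) (Fin n) ℝ}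
    (h : IsHalfIntegral ((M : ℝ) • T)) (i j : Fin n) :
    ∃ z : ℤ, 2 * (M : ℝ) * T i j = z := by
  by_cases hij : i = j
  · subst hij
    obtain ⟨z, hz⟩ := h.1 i
    refine ⟨2 * z, ?_⟩
    simp only [Matrix.smul_apply, smul_eq_mul] at hz
    push_cast; linarith
  · obtain ⟨z, hz⟩ := h.2 i j hij
    refine ⟨z, ?_⟩
    simp only [Matrix.smul_apply, smul_eq_mul] at hz
    linarith

lemma aux_sum {n : ℕ} (M : ℕ) (hM : 1 ≤ M) (c : ℝ) (hc : 0 < c)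
    (P : Matrix (Fin n) (Fin n) ℝ → Prop)
    (hP : ∀ T, P T → IsHalfIntegral ((M : ℝ) • T))
    (s : Finset {T : Matrix (Fin n) (Fin n) ℝ // P T}) :
    ∑ T ∈ s, ∏ p : Fin n × Fin n, Real.exp (-(c * |T.1 p.1 p.2|)) ≤
      (2 * (1 + 2 / c) * M) ^ (n * n) := by
  have hM1 : (1 : ℝ) ≤ M := by exact_mod_cast hM
  have hM0 : (0 : ℝ) < M := by linarith
  have hex : ∀ (T : {T : Matrix (Fin n) (Fin n) ℝ // P T}) (p : Fin n × Fin n),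
      ∃ z : ℤ, 2 * (M : ℝ) * T.1 p.1 p.2 = z := fun T p => aux_entry_int (hP _ T.2) p.1 p.2
  choose f hf using hex
  have hinj : Function.Injective f := by
    intro T T' h
    apply Subtype.ext
    ext i j
    have h1 := hf T (i, j)
    rw [h, ← hf T' (i, j)] at h1
    exact mul_left_cancel₀ (by positivity) h1
  set N : ℕ := s.sup (fun T => Finset.univ.sup (fun p => (f T p).natAbs)) with hN
  have hmem : ∀ T ∈ s, f T ∈ Fintype.piFinset
      (fun _ : Fin n × Fin n => Finset.Icc (-(N : ℤ)) N) := by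
    intro T hT
    rw [Fintype.mem_piFinset]
    intro p
    have h1 : (f T p).natAbs ≤ Finset.univ.sup (fun p => (f T p).natAbs) :=
      Finset.le_sup (f := fun p => (f T p).natAbs) (Finset.mem_univ p)
    have h2 : Finset.univ.sup (fun p => (f T p).natAbs) ≤ N :=
      Finset.le_sup (f := fun T => Finset.univ.sup (fun p => (f T p).natAbs)) hT
    rw [Finset.mem_Icc]
    omega
  have hterm : ∀ T, ∏ p : Fin n × Fin n, Real.exp (-(c * |T.1 p.1 p.2|)) =
      ∏ p : Fin n × Fin n, Real.exp (-(c / (2 * M) * |(f T p : ℝ)|)) := by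
    intro T
    refine Finset.prod_congr rfl fun p _ => ?_
    rw [← hf, abs_mul, abs_of_pos (by positivity : (0 : ℝ) < 2 * M)]
    congr 1
    field_simp
  calc _ = ∑ z ∈ s.image f, ∏ p : Fin n × Fin n, Real.exp (-(c / (2 * M) * |(z p : ℝ)|)) := by
        rw [Finset.sum_image (fun _ _ _ _ h => hinj h)]
        exact Finset.sum_congr rfl fun T _ => hterm T
    _ ≤ ∑ z ∈ Fintype.piFinset (fun _ : Fin n × Fin n => Finset.Icc (-(N : ℤ)) N),
          ∏ p : Fin n × Fin n, Real.exp (-(c / (2 * M) * |(z p : ℝ)|)) := by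
        apply Finset.sum_le_sum_of_subset_of_nonneg
        · intro z hz
          obtain ⟨T, hT, rfl⟩ := Finset.mem_image.1 hz
          exact hmem T hT
        · intro _ _ _; positivity
    _ = ∏ p : Fin n × Fin n, ∑ z ∈ Finset.Icc (-(N : ℤ)) N,
          Real.exp (-(c / (2 * M) * |(z : ℝ)|)) := by
        rw [Finset.prod_univ_sum]
    _ ≤ ∏ p : Fin n × Fin n, (2 * (1 + 2 / c) * M) := by
        refine Finset.prod_le_prod (fun _ _ => Finset.sum_nonneg fun _ _ => by positivity)
          fun _ _ => ?_
        refine (aux_int _ (by positivity) N).trans ?_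
        have : 1 / (c / (2 * M)) = 2 / c * M := by field_simp
        rw [this]
        nlinarith
    _ = _ := by simp

theorem tail_sum_bound (n : ℕ) (hn : 1 ≤ n) (ℓ : ℝ) (hℓ : 0 ≤ ℓ) (μ : ℝ)
    (hμ0 : 0 < μ) (hμ1 : μ < 1) :
    ∃ D α : ℝ, 0 < D ∧ 0 < α ∧
      ∀ M : ℕ, 1 ≤ M → ∀ R : ℝ, 0 < R →
        ∀ y : Matrix (Fin n) (Fin n) ℝ, y.IsSymm → y.PosDef →
          (y - μ • (1 : Matrix (Fin n) (Fin n) ℝ)).PosSemidef →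
          (∑' T : {T : Matrix (Fin n) (Fin n) ℝ //
              T.PosDef ∧ IsHalfIntegral ((M : ℝ) • T) ∧ R ≤ T.det},
            T.1.det ^ (ℓ / 2) * y.det ^ (ℓ / 2) *
              Real.exp (-(2 * Real.pi * (T.1 * y).trace))) ≤
            D * (M : ℝ) ^ α * Real.exp (-(Real.pi * μ * n * R ^ ((1 : ℝ) / n)) / 2) := by
  have hn0 : (0 : ℝ) < n := by exact_mod_cast hn
  have hn1 : (1 : ℝ) ≤ n := by exact_mod_cast hn
  have hpi := Real.pi_pos
  set k : ℝ := n * (ℓ / 2) with hk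
  have hk0 : 0 ≤ k := by positivity
  set c : ℝ := Real.pi * μ / (n * n) with hc
  have hc0 : 0 < c := by positivity
  refine ⟨(k + 1) ^ k * (2 * (1 + 2 / c)) ^ (n * n), ((n * n : ℕ) : ℝ), by positivity,
    by push_cast; positivity, ?_⟩
  intro M hM R hR y _ hy hyμ
  have hM0 : (0 : ℝ) < M := by exact_mod_cast hM
  set E := Real.exp (-(Real.pi * μ * n * R ^ ((1 : ℝ) / n)) / 2) with hE
  refine tsum_le_of_sum_le' (by positivity) fun s => ?_
  have hterm : ∀ T : {T : Matrix (Fin n) (Fin n) ℝ //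
              T.PosDef ∧ IsHalfIntegral ((M : ℝ) • T) ∧ R ≤ T.det},
      T.1.det ^ (ℓ / 2) * y.det ^ (ℓ / 2) * Real.exp (-(2 * Real.pi * (T.1 * y).trace)) ≤
      (k + 1) ^ k * E * ∏ p : Fin n × Fin n, Real.exp (-(c * |T.1 p.1 p.2|)) := by
    rintro ⟨T, hT, -, hRT⟩
    simp only
    obtain ⟨t0, d0, hd⟩ := aux_mul hn hT.posSemidef hy.posSemidef
    obtain ⟨_, _, hd1⟩ := aux_amgm hn hT.posSemidef
    have htr : μ * T.trace ≤ (T * y).trace := by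
      have := (aux_mul hn hT.posSemidef hyμ).1
      rw [Matrix.mul_sub, Matrix.trace_sub, Matrix.mul_smul, Matrix.mul_one,
        Matrix.trace_smul, smul_eq_mul] at this
      linarith
    set t := (T * y).trace
    have hRt : μ * n * R ^ ((1 : ℝ) / n) ≤ t := by
      have h1 : R ^ ((1 : ℝ) / n) ≤ T.det ^ ((1 : ℝ) / n) := by gcongr
      have h2 : R ^ ((1 : ℝ) / n) * n ≤ T.trace := by
        rw [← le_div_iff₀ hn0]; exact h1.trans hd1
      nlinarith
    have hpow : T.det ^ (ℓ / 2) * y.det ^ (ℓ / 2) ≤ (k + 1) ^ k * Real.exp (Real.pi / 2 * t) := by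
      rw [← Real.mul_rpow hT.det_pos.le hy.det_pos.le, ← Matrix.det_mul]
      have h1 : (T * y).det ^ (ℓ / 2) = ((T * y).det ^ ((1 : ℝ) / n)) ^ k := by
        rw [← Real.rpow_mul d0, hk]; congr 1; field_simp
      rw [h1]
      calc _ ≤ (t / n) ^ k := by gcongr
        _ ≤ (k + 1) ^ k * Real.exp (t / n) := aux_pow k hk0 _ (by positivity)
        _ ≤ _ := by
          gcongr
          have := Real.pi_gt_three
          calc t / n ≤ t := div_le_self t0 hn1
            _ ≤ _ := by nlinarith
    have hprod : Real.exp (-(Real.pi * t)) ≤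
        ∏ p : Fin n × Fin n, Real.exp (-(c * |T p.1 p.2|)) := by
      rw [← Real.exp_sum, Real.exp_le_exp, Finset.sum_neg_distrib, neg_le_neg_iff]
      calc ∑ p : Fin n × Fin n, c * |T p.1 p.2| ≤ ∑ p : Fin n × Fin n, c * T.trace := by
            refine Finset.sum_le_sum fun p _ => ?_
            have := aux_entry hT.posSemidef p.1 p.2
            gcongr
        _ = Real.pi * (μ * T.trace) := by
            simp [hc]; field_simp
        _ ≤ _ := by gcongr
    calc _ ≤ (k + 1) ^ k * Real.exp (Real.pi / 2 * t) * Real.exp (-(2 * Real.pi * t)) := by gcongr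
      _ = (k + 1) ^ k * Real.exp (-(Real.pi * t) / 2) * Real.exp (-(Real.pi * t)) := by
        rw [mul_assoc ((k + 1) ^ k), mul_assoc ((k + 1) ^ k), ← Real.exp_add, ← Real.exp_add]
        congr 2; ring
      _ ≤ _ := by
        have : Real.exp (-(Real.pi * t) / 2) ≤ E := by
          rw [hE, Real.exp_le_exp]
          nlinarith
        gcongr
  calc _ ≤ ∑ T ∈ s, (k + 1) ^ k * E * ∏ p : Fin n × Fin n, Real.exp (-(c * |T.1 p.1 p.2|)) :=
        Finset.sum_le_sum fun T _ => hterm T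
    _ = (k + 1) ^ k * E * ∑ T ∈ s, ∏ p : Fin n × Fin n, Real.exp (-(c * |T.1 p.1 p.2|)) := by
        rw [Finset.mul_sum]
    _ ≤ (k + 1) ^ k * E * (2 * (1 + 2 / c) * M) ^ (n * n) := by
        gcongr
        exact aux_sum M hM c hc0 _ (fun T h => h.2.1) s
    _ = _ := by
        rw [Real.rpow_natCast, mul_pow]; ring
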